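/- Let n ≥ 2. Every ideal I of the Lie algebra u_n is a characteristic ideal: for every Lie algebra automorphism σ of u_n, σ(I) = I. -/

import Mathlib

open MvPolynomial

noncomputable section


/-- If a derivation of `MvPolynomial σ K` maps every generator `X j`, `j ∈ s`, into the
subalgebra `supported K s` of polynomials supported on `s`, then it maps the whole of
`supported K s` into itself. -/
theorem Derivation.mem_supported_of_forall_mem
    {K : Type*} [CommRing K] {σ : Type*} (s : Set σ)
    (D : Derivation K (MvPolynomial σ K) (MvPolynomial σ K))
    (h : ∀ j ∈ s, D (X j) ∈ supported K s)
    {p : MvPolynomial σ K} (hp : p ∈ supported K s) : D p ∈ supported K s := by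
  rw [supported_eq_adjoin_X] at hp
  induction hp using Algebra.adjoin_induction with
  | mem x hx =>
    obtain ⟨j, hj, rfl⟩ := hx
    exact h j hj
  | algebraMap r =>
    rw [Derivation.map_algebraMap]
    exact zero_mem _
  | add x y hx hy ihx ihy =>
    rw [map_add]
    exact add_mem ihx ihy
  | mul x y hx hy ihx ihy =>
    rw [Derivation.leibniz, smul_eq_mul, smul_eq_mul]
    rw [← supported_eq_adjoin_X] at hx hy
    exact add_mem (mul_mem hx ihy) (mul_mem hy ihx)

/-- If a derivation of `MvPolynomial σ K` kills every generator `X j`, `j ∈ s`, then it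
kills the whole subalgebra `supported K s`. -/
theorem Derivation.eq_zero_of_forall_eq_zero
    {K : Type*} [CommRing K] {σ : Type*} (s : Set σ)
    (D : Derivation K (MvPolynomial σ K) (MvPolynomial σ K))
    (h : ∀ j ∈ s, D (X j) = 0)
    {p : MvPolynomial σ K} (hp : p ∈ supported K s) : D p = 0 := by
  rw [supported_eq_adjoin_X] at hp
  induction hp using Algebra.adjoin_induction with
  | mem x hx =>
    obtain ⟨j, hj, rfl⟩ := hx
    exact h j hj
  | algebraMap r =>
    rw [Derivation.map_algebraMap]
  | add x y hx hy ihx ihy =>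
    rw [map_add, ihx, ihy, add_zero]
  | mul x y hx hy ihx ihy =>
    rw [Derivation.leibniz, ihx, ihy, smul_zero, smul_zero, add_zero]

/-- The defining condition for the Lie algebra `u_n = K∂₁ ⊕ P₁∂₂ ⊕ ⋯ ⊕ P_{n-1}∂ₙ` of
triangular polynomial derivations of `P_n = K[x₁,…,xₙ]` (variables indexed by `Fin n`,
zero-based): a derivation `D` of `P_n` is triangular iff, for every `i`, the polynomial
`D (X i)` only involves the variables `X j` with `j < i` (so the coefficient of `∂_i`
lies in `P_{i-1}`, where `P₀ = K`). -/
def triSet (K : Type*) [Field K] (n : ℕ) :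
    Set (Derivation K (MvPolynomial (Fin n) K) (MvPolynomial (Fin n) K)) :=
  {D | ∀ i : Fin n, D (X i) ∈ supported K {j : Fin n | (j : ℕ) < (i : ℕ)}}

theorem supported_upward {K : Type*} [Field K] {n : ℕ}
    (p : MvPolynomial (Fin n) K) (s t : Set (Fin n)) (hst : s ⊆ t)
    (hp : p ∈ supported K s) : p ∈ supported K t :=
  supported_mono hst hp

theorem triSet_stable {K : Type*} [Field K] {n : ℕ}
    {D : Derivation K (MvPolynomial (Fin n) K) (MvPolynomial (Fin n) K)}
    (hD : D ∈ triSet K n) (i : Fin n) :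
    ∀ j ∈ {j' : Fin n | (j' : ℕ) < (i : ℕ)},
      D (X j) ∈ supported K {j' : Fin n | (j' : ℕ) < (i : ℕ)} := by
  intro j hj
  refine supported_upward _ {j' : Fin n | (j' : ℕ) < (j : ℕ)} _ ?_ (hD j)
  intro l hl
  have hl' : (l : ℕ) < (j : ℕ) := hl
  have hj' : (j : ℕ) < (i : ℕ) := hj
  exact lt_trans hl' hj'

theorem triSet_lie {K : Type*} [Field K] {n : ℕ}
    {a b : Derivation K (MvPolynomial (Fin n) K) (MvPolynomial (Fin n) K)}
    (ha : a ∈ triSet K n) (hb : b ∈ triSet K n) : ⁅a, b⁆ ∈ triSet K n := by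
  intro i
  rw [Derivation.commutator_apply]
  exact sub_mem
    (Derivation.mem_supported_of_forall_mem _ a (triSet_stable ha i) (hb i))
    (Derivation.mem_supported_of_forall_mem _ b (triSet_stable hb i) (ha i))

/-- The Lie algebra `u_n = K∂₁ ⊕ P₁∂₂ ⊕ ⋯ ⊕ P_{n-1}∂ₙ` of triangular polynomial
derivations, as a Lie subalgebra of the Lie algebra of all `K`-derivations of the
polynomial algebra `P_n = K[x₁,…,xₙ]`. -/
def triangular (K : Type*) [Field K] (n : ℕ) :
    LieSubalgebra K (Derivation K (MvPolynomial (Fin n) K) (MvPolynomial (Fin n) K)) where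
  carrier := triSet K n
  add_mem' := fun {a b} ha hb i => by
    rw [Derivation.add_apply]; exact add_mem (ha i) (hb i)
  zero_mem' := fun i => by
    rw [Derivation.zero_apply]; exact zero_mem _
  smul_mem' := fun c a ha i => by
    rw [Derivation.smul_apply]; exact Subalgebra.smul_mem _ (ha i) c
  lie_mem' := fun {a b} ha hb => triSet_lie ha hb

theorem mem_triangular_iff {K : Type*} [Field K] {n : ℕ}
    (D : Derivation K (MvPolynomial (Fin n) K) (MvPolynomial (Fin n) K)) :
    D ∈ triangular K n ↔
      ∀ i : Fin n, D (X i) ∈ supported K {j : Fin n | (j : ℕ) < (i : ℕ)} := Iff.rfl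


/-- Colexicographic key of an exponent. -/
def triKey {n : ℕ} (α : Fin n →₀ ℕ) : Colex (Fin n → ℕ) := toColex (⇑α)

theorem triKey_lt {n : ℕ} {α β : Fin n →₀ ℕ} :
    triKey α < triKey β ↔ ∃ k, (∀ l, k < l → α l = β l) ∧ α k < β k := Iff.rfl

theorem triKey_inj {n : ℕ} {α β : Fin n →₀ ℕ} (h : triKey α = triKey β) : α = β :=
  DFunLike.coe_injective (toColex.injective h)

/-- Position of the basis element `x^α ∂_i`. -/
def triPos {n : ℕ} (i : Fin n) (α : Fin n →₀ ℕ) : (Fin n)ᵒᵈ ×ₗ Colex (Fin n → ℕ) :=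
  toLex (OrderDual.toDual i, triKey α)

theorem triPos_lt {n : ℕ} {i j : Fin n} {α β : Fin n →₀ ℕ} :
    triPos j β < triPos i α ↔ i < j ∨ (j = i ∧ triKey β < triKey α) := by
  unfold triPos
  rw [Prod.Lex.toLex_lt_toLex]
  rfl

/-- `x^α ∂_i` is the leading basis element of `u`. -/
def TriLead {K : Type*} [Field K] {n : ℕ} (u : triangular K n) (i : Fin n)
    (α : Fin n →₀ ℕ) : Prop :=
  (∀ j, j < i → u.1 (X j) = 0) ∧ coeff α (u.1 (X i)) ≠ 0 ∧
    ∀ β, coeff β (u.1 (X i)) ≠ 0 → triKey β ≤ triKey α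

theorem exists_triLead_of_ne {K : Type*} [Field K] {n : ℕ} (u : triangular K n) (i : Fin n)
    (h : ∀ j, j < i → u.1 (X j) = 0) (hi : u.1 (X i) ≠ 0) : ∃ α, TriLead u i α := by
  obtain ⟨α, h1, h2⟩ := Finset.exists_max_image (u.1 (X i)).support triKey
    (by simpa [Finset.nonempty_iff_ne_empty] using hi)
  refine ⟨α, h, by simpa using h1, fun β hβ => h2 β (by simpa using hβ)⟩

theorem exists_triLead {K : Type*} [Field K] {n : ℕ} (u : triangular K n) (hu : u ≠ 0) :
    ∃ i α, TriLead u i α := by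
  have hex : ∃ i : Fin n, u.1 (X i) ≠ 0 := by
    by_contra hcon
    push Not at hcon
    apply hu
    apply Subtype.ext
    apply MvPolynomial.derivation_ext
    intro i
    rw [hcon i]
    simp
  obtain ⟨i, hi, hmin⟩ := WellFounded.has_min (wellFounded_lt (α := Fin n))
    {i | u.1 (X i) ≠ 0} hex
  refine ⟨i, exists_triLead_of_ne u i (fun j hj => ?_) hi⟩
  by_contra hne
  exact hmin j hne hj

/-- the derivation `q ∂_k`. -/
def triElt {K : Type*} [Field K] {n : ℕ} (k : Fin n) (q : MvPolynomial (Fin n) K)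
    (hq : q ∈ supported K {j : Fin n | (j : ℕ) < (k : ℕ)}) : triangular K n :=
  ⟨q • pderiv k, by
    intro i
    rw [Derivation.smul_apply]
    by_cases h : i = k
    · subst h
      simpa using hq
    · rw [pderiv_X_of_ne h, smul_zero]
      exact zero_mem _⟩

theorem tri_bracket {K : Type*} [Field K] {n : ℕ} (k : Fin n) (q : MvPolynomial (Fin n) K)
    (hq : q ∈ supported K {j : Fin n | (j : ℕ) < (k : ℕ)}) (u : triangular K n) (i : Fin n) :
    (⁅triElt k q hq, u⁆ : triangular K n).1 (X i) =
      q * pderiv k (u.1 (X i)) - u.1 (q * pderiv k (X i)) := by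
  rw [LieSubalgebra.coe_bracket, Derivation.commutator_apply]
  rfl

/-- exponents of a supported polynomial -/
theorem tri_exp_eq_zero {K : Type*} [Field K] {n : ℕ} {s : Set (Fin n)}
    {p : MvPolynomial (Fin n) K} (hp : p ∈ supported K s) {α : Fin n →₀ ℕ}
    (hα : coeff α p ≠ 0) {l : Fin n} (hl : l ∉ s) : α l = 0 := by
  by_contra h
  apply hl
  rw [mem_supported] at hp
  apply hp
  rw [Finset.mem_coe, mem_vars_iff_mem_support]
  exact ⟨α, by simpa using hα, by simpa using h⟩

theorem tri_monomial_mem {K : Type*} [Field K] {n : ℕ} {s : Set (Fin n)}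
    (α : Fin n →₀ ℕ) (h : ∀ l, l ∉ s → α l = 0) : (monomial α (1 : K)) ∈ supported K s := by
  rw [mem_supported, vars_monomial one_ne_zero]
  intro l hl
  by_contra hls
  have := h l hls
  simp_all

theorem tri_pderiv_eq_zero {K : Type*} [Field K] {n : ℕ} {s : Set (Fin n)}
    {p : MvPolynomial (Fin n) K} (hp : p ∈ supported K s) {k : Fin n} (hk : k ∉ s) :
    pderiv k p = 0 := by
  apply pderiv_eq_zero_of_notMem_vars
  rw [mem_supported] at hp
  exact fun h => hk (hp h)

/-- the key step, same component -/
theorem tri_step_same {K : Type*} [Field K] [CharZero K] {n : ℕ} (u : triangular K n)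
    (i : Fin n) (α β : Fin n →₀ ℕ) (hu : TriLead u i α) (hlt : triKey β < triKey α) :
    ∃ z : triangular K n, ∃ α', TriLead ⁅z, u⁆ i α' ∧ triKey α' < triKey α ∧
      triKey β ≤ triKey α' := by
  obtain ⟨k, hk1, hk2⟩ := triKey_lt.1 hlt
  obtain ⟨hz, hα, hmax⟩ := hu
  have hki : k < i := by
    by_contra hcon
    have := tri_exp_eq_zero (u.2 i) hα (l := k) (by simpa using hcon)
    omega
  let γ : Fin n →₀ ℕ := β.filter (fun l => l < k)
  have hγ0 : ∀ l, k ≤ l → γ l = 0 := fun l hl => Finsupp.filter_apply_neg _ _ (not_lt.2 hl)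
  have hγ1 : ∀ l, l < k → γ l = β l := fun l hl => Finsupp.filter_apply_pos _ _ hl
  have hq : (monomial γ (1 : K)) ∈ supported K {j : Fin n | (j : ℕ) < (k : ℕ)} :=
    tri_monomial_mem γ (fun l hl => hγ0 l (by simpa using hl))
  refine ⟨triElt k _ hq, ?_⟩
  have hcomp : ∀ j, j ≤ i → (⁅triElt k _ hq, u⁆ : triangular K n).1 (X j) =
      monomial γ 1 * pderiv k (u.1 (X j)) := by
    intro j hj
    rw [tri_bracket]
    by_cases hjk : j = k
    · subst hjk
      have : u.1 (monomial γ 1) = 0 := by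
        refine Derivation.eq_zero_of_forall_eq_zero _ u.1 (fun l hl => hz l ?_) hq
        exact lt_trans hl hki
      simp [this]
    · simp [pderiv_X_of_ne hjk]
  obtain ⟨δ, hδ⟩ : ∃ δ : Fin n →₀ ℕ, α = δ + Finsupp.single k 1 := by
    refine ⟨α - Finsupp.single k 1, ?_⟩
    rw [tsub_add_cancel_of_le]
    rw [Finsupp.single_le_iff]
    omega
  have hc : coeff (γ + δ) ((⁅triElt k _ hq, u⁆ : triangular K n).1 (X i)) ≠ 0 := by
    rw [hcomp i le_rfl, coeff_monomial_mul, coeff_pderiv, ← hδ, one_mul]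
    exact mul_ne_zero hα (Nat.cast_add_one_ne_zero _)
  obtain ⟨α', hα'⟩ := exists_triLead_of_ne (⁅triElt k _ hq, u⁆ : triangular K n) i
    (fun j hj => by rw [hcomp j hj.le, hz j hj]; simp) (fun h0 => hc (by rw [h0]; simp))
  refine ⟨α', hα', ?_, ?_⟩
  · have h1 := hα'.2.1
    rw [hcomp i le_rfl, coeff_monomial_mul'] at h1
    split_ifs at h1 with hle
    · rw [one_mul, coeff_pderiv] at h1
      have h2 := hmax _ (left_ne_zero_of_mul h1)
      refine lt_of_lt_of_le (triKey_lt.2 ⟨k, fun l hl => ?_, ?_⟩) h2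
      · have := hγ0 l hl.le
        simp [this, hl.ne]
      · have := hγ0 k le_rfl
        simp [this]
    · exact absurd rfl h1
  · refine le_trans ?_ (hα'.2.2 _ hc)
    have hαk : ∀ l, α l = δ l + Finsupp.single k 1 l := fun l => by rw [hδ]; rfl
    by_cases hkk : β k = δ k
    · apply Pi.toColex_monotone
      intro l
      rcases lt_trichotomy l k with h | h | h
      · simp [hγ1 l h]
      · subst h; simp [hkk]
      · have := hk1 l h
        have h2 := hαk l
        simp [h.ne] at h2
        simp; omega
    · refine (triKey_lt.2 ⟨k, fun l hl => ?_, ?_⟩).le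
      · have := hk1 l hl
        have h2 := hαk l
        simp [hl.ne] at h2
        simp [hγ0 l hl.le]; omega
      · have h2 := hαk k
        simp at h2
        simp; omega

/-- the key step, next component -/
theorem tri_step_next {K : Type*} [Field K] [CharZero K] {n : ℕ} (u : triangular K n)
    (i j : Fin n) (hij : i < j) (α β : Fin n →₀ ℕ) (hu : TriLead u i α)
    (hβ : ∀ l, j ≤ l → β l = 0) :
    ∃ z : triangular K n, ∃ i' α', TriLead ⁅z, u⁆ i' α' ∧ i < i' ∧
      triPos j β ≤ triPos i' α' := by
  obtain ⟨hz, hα, hmax⟩ := hu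
  obtain ⟨i', hi'⟩ : ∃ i' : Fin n, (i' : ℕ) = i + 1 := ⟨⟨i + 1, by omega⟩, rfl⟩
  have hii : i < i' := by rw [Fin.lt_def]; omega
  let M := β i + 1
  have hq : ((X i : MvPolynomial (Fin n) K) ^ (M + 1)) ∈
      supported K {j : Fin n | (j : ℕ) < (i' : ℕ)} :=
    pow_mem (X_mem_supported.2 (show i ∈ {j : Fin n | (j : ℕ) < (i' : ℕ)} from hii)) _
  refine ⟨triElt i' _ hq, i', ?_⟩
  have hlow : ∀ l, l < i' → (⁅triElt i' _ hq, u⁆ : triangular K n).1 (X l) = 0 := by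
    intro l hl
    rw [tri_bracket, pderiv_X_of_ne hl.ne, tri_pderiv_eq_zero (u.2 l)]
    · simp
    · simpa using hl.le
  have hcomp : (⁅triElt i' _ hq, u⁆ : triangular K n).1 (X i') =
      - (monomial (Finsupp.single i M) ((M : K) + 1) * u.1 (X i)) := by
    rw [tri_bracket, tri_pderiv_eq_zero (u.2 i') (by simp), pderiv_X_self, mul_one, mul_zero,
      zero_sub, Derivation.leibniz_pow, ← mul_one ((M : K) + 1), ← C_mul_monomial,
      ← X_pow_eq_monomial]
    simp [mul_assoc]
    try ring
  have hc : coeff (Finsupp.single i M + α)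
      ((⁅triElt i' _ hq, u⁆ : triangular K n).1 (X i')) ≠ 0 := by
    rw [hcomp, coeff_neg, coeff_monomial_mul]
    exact neg_ne_zero.2 (mul_ne_zero (Nat.cast_add_one_ne_zero M) hα)
  obtain ⟨α', hα'⟩ := exists_triLead_of_ne (⁅triElt i' _ hq, u⁆ : triangular K n) i'
    hlow (fun h0 => hc (by rw [h0]; simp))
  refine ⟨α', hα', hii, le_of_lt ?_⟩
  rw [triPos_lt]
  rcases eq_or_ne j i' with h | h
  · right
    refine ⟨h, lt_of_lt_of_le ?_ (hα'.2.2 _ hc)⟩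
    refine triKey_lt.2 ⟨i, fun l hl => ?_, ?_⟩
    · have h1 : β l = 0 := hβ l (by rw [h, Fin.le_def, hi']; exact hl)
      have h2 : α l = 0 := tri_exp_eq_zero (u.2 i) hα (by simpa using hl.le)
      simp [h1, h2, hl.ne]
    · simp [M]; omega
  · left
    have : (j : ℕ) ≠ i' := fun h' => h (Fin.ext h')
    rw [Fin.lt_def] at hij ⊢
    omega

theorem tri_main {K : Type*} [Field K] [CharZero K] {n : ℕ} (I : LieIdeal K (triangular K n))
    (b : (Fin n)ᵒᵈ ×ₗ Colex (Fin n → ℕ)) :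
    ∀ (u w : triangular K n) (i j : Fin n) (α β : Fin n →₀ ℕ), u ∈ I → TriLead u i α →
      TriLead w j β → triPos i α = b → triPos j β ≤ b → w ∈ I := by
  induction b using WellFoundedLT.induction with
  | ind b ih =>
  have hlt : ∀ (u w : triangular K n) (i j : Fin n) (α β : Fin n →₀ ℕ), u ∈ I → TriLead u i α →
      TriLead w j β → triPos i α = b → triPos j β < b → w ∈ I := by
    intro u w i j α β hu hlu hlw hb hlt
    subst hb
    rcases triPos_lt.1 hlt with h | ⟨h, h'⟩
    · obtain ⟨z, i', α', h1, h2, h3⟩ := tri_step_next u i j h α β hlu (fun l hl =>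
        tri_exp_eq_zero (w.2 j) hlw.2.1 (by simpa using hl))
      exact ih _ (triPos_lt.2 (Or.inl h2)) _ w _ _ _ _ (lie_mem_right K _ I z u hu) h1 hlw rfl h3
    · subst h
      obtain ⟨z, α', h1, h2, h3⟩ := tri_step_same u j α β hlu h'
      refine ih _ (triPos_lt.2 (Or.inr ⟨rfl, h2⟩)) _ w _ _ _ _ (lie_mem_right K _ I z u hu)
        h1 hlw rfl ?_
      rcases h3.lt_or_eq with h3 | h3
      · exact (triPos_lt.2 (Or.inr ⟨rfl, h3⟩)).le
      · simp [triPos, h3]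
  intro u w i j α β hu hlu hlw hb hle
  rcases hle.lt_or_eq with h | h
  · exact hlt u w i j α β hu hlu hlw hb h
  subst hb
  have hji : j = i := by
    have := congrArg (fun x => OrderDual.ofDual (ofLex x).1) h
    exact this
  have hβα : β = α := triKey_inj (congrArg (fun x => (ofLex x).2) h)
  subst hji hβα
  let c : K := coeff β (w.1 (X j)) / coeff β (u.1 (X j))
  have hmem : w - c • u ∈ I := by
    by_cases h0 : w - c • u = 0
    · rw [h0]; exact zero_mem _
    obtain ⟨i', α', hl⟩ := exists_triLead _ h0
    refine hlt u _ _ _ _ _ hu hlu hl rfl (triPos_lt.2 ?_)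
    have happ : ∀ l, (w - c • u).1 (X l) = w.1 (X l) - c • u.1 (X l) := fun l => rfl
    have h1 := hl.2.1
    rw [happ] at h1
    rcases lt_trichotomy j i' with h' | h' | h'
    · exact Or.inl h'
    · right
      subst h'
      refine ⟨rfl, lt_of_le_of_ne ?_ ?_⟩
      · by_cases hw : coeff α' (w.1 (X j)) = 0
        · apply hlu.2.2
          intro hu0
          apply h1
          simp [hw, hu0]
        · exact hlw.2.2 _ hw
      · intro he
        apply h1
        rw [triKey_inj he]
        have := hlu.2.1
        simp [c]
        field_simp
        try simp
    · exfalso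
      apply h1
      simp [hlu.1 _ h', hlw.1 _ h']
  have := add_mem hmem (I.smul_mem c hu)
  simpa using this

/-- Iterated preimages of an ideal. -/
def triIter {K : Type*} [Field K] {n : ℕ} (I : LieIdeal K (triangular K n))
    (g : triangular K n →ₗ⁅K⁆ triangular K n) : ℕ → LieIdeal K (triangular K n)
  | 0 => I
  | k + 1 => (triIter I g k).comap g

theorem tri_pull {K : Type*} [Field K] [CharZero K] {n : ℕ}
    (I : LieIdeal K (triangular K n)) (e : triangular K n ≃ₗ⁅K⁆ triangular K n)
    (u : triangular K n) (hu : e u ∈ I) : u ∈ I := by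
  by_contra hnot
  let J := triIter I e.symm.toLieHom
  have hJ : ∀ k x, e x ∈ J (k + 1) ↔ x ∈ J k := by
    intro k x
    change e x ∈ (triIter I e.symm.toLieHom k).comap e.symm.toLieHom ↔ _
    rw [LieIdeal.mem_comap]
    change e.symm (e x) ∈ J k ↔ _
    rw [LieEquiv.symm_apply_apply]
  let x : ℕ → triangular K n := fun k => e^[k] (e u)
  have hxs : ∀ k, x (k + 1) = e (x k) := fun k => Function.iterate_succ_apply' _ _ _
  have hin : ∀ k, x k ∈ J k := by
    intro k
    induction k with
    | zero => exact hu
    | succ k ih => rw [hxs, hJ]; exact ih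
  have hout : ∀ k, x k ∉ J (k + 1) := by
    intro k
    induction k with
    | zero => exact fun h => hnot ((hJ 0 u).1 h)
    | succ k ih => rw [hxs, hJ]; exact ih
  have hlead : ∀ k, ∃ i α, TriLead (x k) i α := fun k =>
    exists_triLead _ (fun h0 => hout k (by rw [h0]; exact zero_mem _))
  choose i α hl using hlead
  obtain ⟨_, ⟨k, rfl⟩, hmin⟩ := WellFounded.has_min
    (wellFounded_lt (α := (Fin n)ᵒᵈ ×ₗ Colex (Fin n → ℕ)))
    (Set.range fun k => triPos (i k) (α k)) (Set.range_nonempty _)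
  exact hout k (tri_main (J (k + 1)) _ (x (k + 1)) (x k) _ _ _ _ (hin (k + 1)) (hl (k + 1))
    (hl k) rfl (not_lt.1 (hmin _ ⟨k + 1, rfl⟩)))

/-- For `n ≥ 2`, every ideal of the Lie algebra `u_n` is a characteristic
ideal: it is invariant under every Lie algebra automorphism of `u_n`. -/
theorem triangular_ideals_characteristic
    (K : Type*) [Field K] [CharZero K] (n : ℕ) (hn : 2 ≤ n)
    (I : LieIdeal K ↥(triangular K n))
    (e : ↥(triangular K n) ≃ₗ⁅K⁆ ↥(triangular K n)) :
    e '' (I : Set ↥(triangular K n)) = (I : Set ↥(triangular K n)) := by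
  ext x
  constructor
  · rintro ⟨y, hy, rfl⟩
    refine tri_pull I e.symm (e y) ?_
    rw [LieEquiv.symm_apply_apply]
    exact hy
  · intro hx
    refine ⟨e.symm x, tri_pull I e _ ?_, e.apply_symm_apply x⟩
    rw [LieEquiv.apply_symm_apply]
    exact hx
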